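/- arXiv:gr-qc/0207110 — 9 statements merged into one kernel-verified Lean document; each statement's English description precedes it below -/
import Mathlib

section
/- (Criterion 1(i), pointwise form.) Let n ≥ 2, r ≥ 1, and let T be an r-multilinear map on n-dimensional Minkowski vector space. Then T has the dominant property (T ∈ DP⁺_r) if and only if T(k₁,...,k_r) ≥ 0 for every r-tuple k₁,...,k_r of future-directed null vectors. -/
namespace PaperCausal

variable {n : ℕ}

/-- The Lorentzian (Minkowski) bilinear form on `Fin n → ℝ`:
`η x y = x 0 * y 0 - ∑_{i ≠ 0} x i * y i`. -/
noncomputable def eta [NeZero n] (x y : Fin n → ℝ) : ℝ :=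
  x 0 * y 0 - ∑ i ∈ Finset.univ.filter (fun i => i ≠ (0 : Fin n)), x i * y i

/-- `x ∈ Θ⁺`: future-directed causal vector. -/
def FutureCausal [NeZero n] (x : Fin n → ℝ) : Prop :=
  0 ≤ eta x x ∧ 0 < x 0

/-- Future-directed null vector. -/
def FutureNull [NeZero n] (x : Fin n → ℝ) : Prop :=
  eta x x = 0 ∧ 0 < x 0

/-- Future-directed timelike vector. -/
def FutureTimelike [NeZero n] (x : Fin n → ℝ) : Prop :=
  0 < eta x x ∧ 0 < x 0

/-- The dominant property `T ∈ DP⁺_r` for an `r`-multilinear map. -/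
def DPplus [NeZero n] {r : ℕ} (T : MultilinearMap ℝ (fun _ : Fin r => (Fin n → ℝ)) ℝ) : Prop :=
  ∀ v : Fin r → (Fin n → ℝ), (∀ i, FutureCausal (v i)) → 0 ≤ T v

/-- The dominant property `T ∈ DP⁺_2` for a bilinear form. -/
def DP2 [NeZero n] (T : (Fin n → ℝ) →ₗ[ℝ] (Fin n → ℝ) →ₗ[ℝ] ℝ) : Prop :=
  ∀ u v : Fin n → ℝ, FutureCausal u → FutureCausal v → 0 ≤ T u v

/-- A future-directed causal vector is a convex combination of two future-directed null vectors,
obtained by changing a single spatial coordinate. -/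
theorem FutureCausal.exists_null_decomposition [NeZero n] (hn : 2 ≤ n) {v : Fin n → ℝ}
    (hv : FutureCausal v) :
    ∃ (a b : ℝ) (k l : Fin n → ℝ), 0 ≤ a ∧ 0 ≤ b ∧ FutureNull k ∧ FutureNull l ∧
      v = a • k + b • l := by
  obtain ⟨j, hj⟩ : ∃ j : Fin n, j ≠ 0 := by
    have : Nontrivial (Fin n) := Fin.nontrivial_iff_two_le.mpr hn
    exact exists_ne 0
  have eta_update (t : ℝ) : eta (Function.update v j t) (Function.update v j t)
      = eta v v + v j ^ 2 - t ^ 2 := by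
    have hmem : j ∈ Finset.univ.filter (fun i => i ≠ (0 : Fin n)) := by simp [hj]
    unfold eta
    rw [← Finset.add_sum_erase _ _ hmem, ← Finset.add_sum_erase _ _ hmem]
    have hsum : ∑ i ∈ (Finset.univ.filter (fun i => i ≠ (0 : Fin n))).erase j,
        Function.update v j t i * Function.update v j t i
        = ∑ i ∈ (Finset.univ.filter (fun i => i ≠ (0 : Fin n))).erase j, v i * v i :=
      Finset.sum_congr rfl fun i hi => by
        rw [Function.update_of_ne (Finset.ne_of_mem_erase hi)]
    rw [hsum, Function.update_self, Function.update_of_ne hj.symm]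
    ring
  obtain ⟨hη, h0⟩ := hv
  set s := √(eta v v + v j ^ 2) with hs
  have hs2 : s ^ 2 = eta v v + v j ^ 2 := Real.sq_sqrt (by positivity)
  have hs0 : 0 ≤ s := Real.sqrt_nonneg _
  have habs : |v j| ≤ s := Real.abs_le_sqrt (by linarith)
  have null (t : ℝ) (ht : t ^ 2 = s ^ 2) : FutureNull (Function.update v j t) :=
    ⟨by rw [eta_update, ht, hs2, sub_self], by rwa [Function.update_of_ne hj.symm]⟩
  obtain ⟨hl, hr⟩ := abs_le.mp habs
  rcases hs0.eq_or_lt with hs' | hs'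
  · have hvj : v j = s := by linarith
    have hnull : FutureNull v := by simpa using null (v j) (by rw [hvj])
    exact ⟨1, 0, v, v, zero_le_one, le_rfl, hnull, hnull, by simp⟩
  · refine ⟨(s + v j) / (2 * s), (s - v j) / (2 * s), Function.update v j s,
      Function.update v j (-s), div_nonneg (by linarith) (by linarith),
      div_nonneg (by linarith) (by linarith), null _ rfl, null _ (by ring), ?_⟩
    ext i
    by_cases hi : i = j
    · subst hi
      simp only [Pi.add_apply, Pi.smul_apply, Function.update_self, smul_eq_mul]
      field_simp
      ring
    · simp only [Pi.add_apply, Pi.smul_apply, Function.update_of_ne hi, smul_eq_mul]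
      field_simp
      ring

theorem criterion1_i (n r : ℕ) [NeZero n] (hn : 2 ≤ n) (hr : 1 ≤ r)
    (T : MultilinearMap ℝ (fun _ : Fin r => (Fin n → ℝ)) ℝ) :
    DPplus T ↔
      ∀ k : Fin r → (Fin n → ℝ), (∀ i, FutureNull (k i)) → 0 ≤ T k := by
  refine ⟨fun h k hk => h k fun i => ⟨(hk i).1.ge, (hk i).2⟩, fun h => ?_⟩
  have key (S : Finset (Fin r)) : ∀ v : Fin r → (Fin n → ℝ),
      (∀ i ∈ S, FutureCausal (v i)) → (∀ i ∉ S, FutureNull (v i)) → 0 ≤ T v := by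
    induction S using Finset.induction_on with
    | empty => exact fun v _ hv => h v fun i => hv i (by simp)
    | insert i S hi ih =>
      intro v hc hv
      obtain ⟨a, b, k, l, ha, hb, hk, hl, hvi⟩ :=
        (hc i (Finset.mem_insert_self i S)).exists_null_decomposition hn
      have nonneg (w : Fin n → ℝ) (hw : FutureNull w) : 0 ≤ T (Function.update v i w) := by
        refine ih _ (fun m hm => ?_) fun m hm => ?_
        · rw [Function.update_of_ne (ne_of_mem_of_not_mem hm hi)]
          exact hc m (Finset.mem_insert_of_mem hm)
        · by_cases hmi : m = i
          · rwa [hmi, Function.update_self]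
          · rw [Function.update_of_ne hmi]
            exact hv m (by simp [hmi, hm])
      rw [← Function.update_eq_self i v, hvi, T.map_update_add, T.map_update_smul,
        T.map_update_smul]
      exact add_nonneg (mul_nonneg ha (nonneg k hk)) (mul_nonneg hb (nonneg l hl))
  exact fun v hv => key Finset.univ v (fun i _ => hv i) fun i hi => absurd (Finset.mem_univ i) hi

end PaperCausal
end

section
/- (Criterion 1(ii), pointwise form.) Let n ≥ 2, r ≥ 1, and let T be an r-multilinear map on n-dimensional Minkowski vector space. Then T has the dominant property and T ≠ 0 if and only if T(u₁,...,u_r) > 0 for every r-tuple u₁,...,u_r of future-directed timelike vectors. -/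
namespace PaperCausal

variable {n : ℕ}

theorem FutureTimelike.futureCausal [NeZero n] {x : Fin n → ℝ} (hx : FutureTimelike x) :
    FutureCausal x :=
  ⟨hx.1.le, hx.2⟩

theorem isOpen_setOf_futureTimelike [NeZero n] : IsOpen {x : Fin n → ℝ | FutureTimelike x} := by
  have h : Continuous fun x : Fin n → ℝ => eta x x := by
    unfold eta
    fun_prop
  exact (isOpen_lt continuous_const h).inter (isOpen_lt continuous_const (continuous_apply 0))

theorem FutureTimelike.exists_add_sub_smul [NeZero n] {u : Fin n → ℝ} (hu : FutureTimelike u)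
    (x : Fin n → ℝ) :
    ∃ ε : ℝ, 0 < ε ∧ FutureTimelike (u + ε • x) ∧ FutureTimelike (u - ε • x) := by
  have hp : ContinuousAt (fun ε : ℝ => u + ε • x) 0 := by fun_prop
  have hm : ContinuousAt (fun ε : ℝ => u - ε • x) 0 := by fun_prop
  have hp' := hp.eventually_mem (isOpen_setOf_futureTimelike.mem_nhds (by simpa using hu))
  have hm' := hm.eventually_mem (isOpen_setOf_futureTimelike.mem_nhds (by simpa using hu))
  obtain ⟨ε, ⟨h₁, h₂⟩, hε⟩ :=
    (((hp'.and hm').filter_mono nhdsWithin_le_nhds).and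
      (self_mem_nhdsWithin : Set.Ioi (0 : ℝ) ∈ nhdsWithin 0 (Set.Ioi 0))).exists
  exact ⟨ε, hε, h₁, h₂⟩

theorem futureTimelike_single [NeZero n] : FutureTimelike (Pi.single (0 : Fin n) (1 : ℝ)) := by
  have h : ∑ i ∈ Finset.univ.filter (fun i => i ≠ (0 : Fin n)),
      (Pi.single (0 : Fin n) (1 : ℝ) : Fin n → ℝ) i *
        (Pi.single (0 : Fin n) (1 : ℝ) : Fin n → ℝ) i = 0 :=
    Finset.sum_eq_zero fun i hi => by simp [(Finset.mem_filter.1 hi).2]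
  constructor
  · rw [eta, h]
    simp
  · simp

theorem FutureCausal.add_smul_single [NeZero n] {x : Fin n → ℝ} (hx : FutureCausal x) {ε : ℝ}
    (hε : 0 < ε) : FutureTimelike (x + ε • Pi.single (0 : Fin n) (1 : ℝ)) := by
  obtain ⟨h, h0⟩ := hx
  have hs : ∑ i ∈ Finset.univ.filter (fun i => i ≠ (0 : Fin n)),
      (x + ε • Pi.single (0 : Fin n) (1 : ℝ) : Fin n → ℝ) i *
        (x + ε • Pi.single (0 : Fin n) (1 : ℝ) : Fin n → ℝ) i =
      ∑ i ∈ Finset.univ.filter (fun i => i ≠ (0 : Fin n)), x i * x i :=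
    Finset.sum_congr rfl fun i hi => by simp [(Finset.mem_filter.1 hi).2]
  constructor
  · rw [eta] at h ⊢
    rw [hs]
    simp only [Pi.add_apply, Pi.smul_apply, Pi.single_eq_same, smul_eq_mul, mul_one]
    nlinarith [mul_pos hε h0]
  · simp only [Pi.add_apply, Pi.smul_apply, Pi.single_eq_same, smul_eq_mul, mul_one]
    positivity

/-- A linear functional that is nonnegative on timelike vectors and vanishes at one of them is
zero. -/
theorem FutureTimelike.linearMap_eq_zero [NeZero n] {L : (Fin n → ℝ) →ₗ[ℝ] ℝ}
    (hL : ∀ x, FutureTimelike x → 0 ≤ L x) {u : Fin n → ℝ} (hu : FutureTimelike u)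
    (hLu : L u = 0) : L = 0 := by
  refine LinearMap.ext fun x => ?_
  obtain ⟨ε, hε, hp, hm⟩ := hu.exists_add_sub_smul x
  have h₁ := hL _ hp
  have h₂ := hL _ hm
  simp only [map_add, map_sub, map_smul, hLu, smul_eq_mul] at h₁ h₂
  have h : ε * L x = 0 := by linarith
  simpa [hε.ne'] using h

theorem DPplus.map_eq_zero_of_futureTimelike [NeZero n] {r : ℕ}
    {T : MultilinearMap ℝ (fun _ : Fin r => (Fin n → ℝ)) ℝ} (hT : DPplus T)
    {u : Fin r → (Fin n → ℝ)} (hu : ∀ i, FutureTimelike (u i)) (hTu : T u = 0)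
    {w : Fin r → (Fin n → ℝ)} (hw : ∀ i, FutureTimelike (w i)) : T w = 0 := by
  have key : ∀ s : Finset (Fin r), T (s.piecewise w u) = 0 := by
    intro s
    induction s using Finset.induction_on with
    | empty => simpa using hTu
    | insert i s hi ih =>
      have hv : ∀ j, FutureTimelike (s.piecewise w u j) := fun j => by
        by_cases hj : j ∈ s <;> simp [hj, hu j, hw j]
      have hL : T.toLinearMap (s.piecewise w u) i = 0 := by
        refine (hv i).linearMap_eq_zero (fun x hx => hT _ fun j => ?_) ?_
        · rcases eq_or_ne j i with rfl | hj
          · simpa using hx.futureCausal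
          · simpa [hj] using (hv j).futureCausal
        · simpa using ih
      rw [Finset.piecewise_insert]
      exact LinearMap.congr_fun hL (w i)
  simpa using key Finset.univ

theorem multilinearMap_eq_zero_of_futureTimelike [NeZero n] {r : ℕ}
    {T : MultilinearMap ℝ (fun _ : Fin r => (Fin n → ℝ)) ℝ}
    (hT : ∀ u, (∀ i, FutureTimelike (u i)) → T u = 0) : T = 0 := by
  have key : ∀ (s : Finset (Fin r)) (u : Fin r → (Fin n → ℝ)),
      (∀ i ∉ s, FutureTimelike (u i)) → T u = 0 := by
    intro s
    induction s using Finset.induction_on with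
    | empty => exact fun u hu => hT u fun i => hu i (by simp)
    | insert i s hi ih =>
      intro u hu
      have hz : ∀ x, FutureTimelike x → T.toLinearMap u i x = 0 := fun x hx => ih _ fun j hj => by
        rcases eq_or_ne j i with rfl | hji
        · simpa using hx
        · simpa [hji] using hu j (by simp [hji, hj])
      have hL : T.toLinearMap u i = 0 :=
        futureTimelike_single.linearMap_eq_zero (fun x hx => (hz x hx).ge)
          (hz _ futureTimelike_single)
      simpa using LinearMap.congr_fun hL (u i)
  refine MultilinearMap.ext fun u => ?_
  exact key Finset.univ u (by simp)

theorem dPplus_of_futureTimelike [NeZero n] {r : ℕ}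
    {T : MultilinearMap ℝ (fun _ : Fin r => (Fin n → ℝ)) ℝ}
    (hT : ∀ u, (∀ i, FutureTimelike (u i)) → 0 ≤ T u) : DPplus T := by
  have key : ∀ (s : Finset (Fin r)) (u : Fin r → (Fin n → ℝ)),
      (∀ i ∈ s, FutureCausal (u i)) → (∀ i ∉ s, FutureTimelike (u i)) → 0 ≤ T u := by
    intro s
    induction s using Finset.induction_on with
    | empty => exact fun u _ hu => hT u fun i => hu i (by simp)
    | insert i s hi ih =>
      intro u hc ht
      have hL : ∀ ε : ℝ, 0 < ε → 0 ≤ T u + ε * T.toLinearMap u i (Pi.single 0 1) := by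
        intro ε hε
        have h : 0 ≤ T.toLinearMap u i (u i + ε • Pi.single 0 1) := by
          refine ih _ (fun j hj => ?_) fun j hj => ?_
          · have hji : j ≠ i := ne_of_mem_of_not_mem hj hi
            simpa [hji] using hc j (by simp [hj])
          · rcases eq_or_ne j i with rfl | hji
            · simpa using (hc j (by simp)).add_smul_single hε
            · simpa [hji] using ht j (by simp [hji, hj])
        rw [map_add, map_smul] at h
        simpa using h
      have hlim : Continuous fun ε : ℝ => T u + ε * T.toLinearMap u i (Pi.single 0 1) := by
        fun_prop
      have hlim' := (hlim.tendsto 0).mono_left (nhdsWithin_le_nhds (s := Set.Ioi 0))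
      simp only [zero_mul, add_zero] at hlim'
      refine ge_of_tendsto hlim' ?_
      filter_upwards [self_mem_nhdsWithin] with ε hε
      exact hL ε hε
  exact fun v hv => key Finset.univ v (fun i _ => hv i) (by simp)

theorem criterion1_ii (n r : ℕ) [NeZero n] (hn : 2 ≤ n) (hr : 1 ≤ r)
    (T : MultilinearMap ℝ (fun _ : Fin r => (Fin n → ℝ)) ℝ) :
    (DPplus T ∧ T ≠ 0) ↔
      ∀ u : Fin r → (Fin n → ℝ), (∀ i, FutureTimelike (u i)) → 0 < T u := by
  constructor
  · rintro ⟨hT, hT0⟩ u hu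
    refine (hT u fun i => (hu i).futureCausal).lt_of_ne fun h => hT0 ?_
    exact multilinearMap_eq_zero_of_futureTimelike fun w hw =>
      hT.map_eq_zero_of_futureTimelike hu h.symm hw
  · intro h
    refine ⟨dPplus_of_futureTimelike fun u hu => (h u hu).le, ?_⟩
    rintro rfl
    simpa using h (fun _ => Pi.single 0 1) fun _ => futureTimelike_single

end PaperCausal
end

section
/- (Self-duality of the causal cone: the duals of the causal one-forms DP⁺_1 are exactly the future-directed causal vectors together with zero.) Let n ≥ 2 and let w : V → ℝ be a linear functional on n-dimensional Minkowski vector space. Then w(u) ≥ 0 for every u ∈ Θ⁺ if and only if there exists a vector v ∈ V such that w(y) = η v y for all y ∈ V and either v = 0 or v ∈ Θ⁺. -/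
namespace PaperCausal

variable {n : ℕ}

/-- Every linear functional on `Fin n → ℝ` is represented by a vector through `eta`. -/
theorem exists_eq_eta [NeZero n] (w : (Fin n → ℝ) →ₗ[ℝ] ℝ) :
    ∃ v : Fin n → ℝ, ∀ y, w y = eta v y := by
  refine ⟨fun i => if i = 0 then w (Pi.single i 1) else -w (Pi.single i 1), fun y => ?_⟩
  have hsum : w y = ∑ i, y i * w (Pi.single i 1) := by
    conv_lhs => rw [pi_eq_sum_univ' y, map_sum]
    simp only [map_smul, smul_eq_mul]
  rw [hsum, eta, Finset.filter_ne', ← Finset.add_sum_erase _ _ (Finset.mem_univ (0 : Fin n)),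
    sub_eq_add_neg, ← Finset.sum_neg_distrib]
  congr 1
  · simp [mul_comm]
  · refine Finset.sum_congr rfl fun i hi => ?_
    simp [Finset.ne_of_mem_erase hi, mul_comm]

theorem FutureCausal.eta_nonneg [NeZero n] {x y : Fin n → ℝ} (hx : FutureCausal x)
    (hy : FutureCausal y) : 0 ≤ eta x y := by
  obtain ⟨hx, hx0⟩ := hx
  obtain ⟨hy, hy0⟩ := hy
  unfold eta at *
  have hcs := Finset.sum_mul_sq_le_sq_mul_sq
    (Finset.univ.filter (fun i => i ≠ (0 : Fin n))) x y
  simp only [← pow_two, sub_nonneg] at hx hy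
  rw [sub_nonneg]
  refine le_of_sq_le_sq (hcs.trans ?_) (mul_pos hx0 hy0).le
  rw [mul_pow]
  exact mul_le_mul hx hy (Finset.sum_nonneg fun i _ => sq_nonneg _) (sq_nonneg _)

/-- A vector pairing nonnegatively with every future-directed causal vector is zero or
future-directed causal. -/
theorem eq_zero_or_futureCausal_of_eta_nonneg [NeZero n] {v : Fin n → ℝ}
    (h : ∀ u, FutureCausal u → 0 ≤ eta v u) : v = 0 ∨ FutureCausal v := by
  have hv0 : 0 ≤ v 0 := by
    have hpair : ∀ x : Fin n → ℝ, eta x (Pi.single 0 1) = x 0 := fun x => by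
      rw [eta, Finset.sum_eq_zero, Pi.single_eq_same, mul_one, sub_zero]
      intro i hi
      rw [Pi.single_eq_of_ne (Finset.mem_filter.mp hi).2, mul_zero]
    simpa [hpair] using h (Pi.single 0 1) ⟨by simp [hpair], by simp⟩
  set s := ∑ i ∈ Finset.univ.filter (fun i => i ≠ (0 : Fin n)), v i * v i with hs
  have hs0 : 0 ≤ s := Finset.sum_nonneg fun i _ => mul_self_nonneg _
  have hvv : eta v v = v 0 * v 0 - s := rfl
  rcases hs0.eq_or_lt with hs0 | hs0
  · rcases hv0.eq_or_lt with hv0 | hv0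
    · left
      have hzero := (Finset.sum_eq_zero_iff_of_nonneg fun i _ => mul_self_nonneg (v i)).mp hs0.symm
      ext i
      by_cases hi : i = 0
      · rw [hi, ← hv0, Pi.zero_apply]
      · exact mul_self_eq_zero.mp (hzero i (by simp [hi]))
    · exact .inr ⟨by rw [hvv, ← hs0, sub_zero]; exact mul_self_nonneg _, hv0⟩
  · have hr := Real.sqrt_pos.mpr hs0
    have hrr := Real.mul_self_sqrt hs0.le
    have hsum : ∀ x : Fin n → ℝ, ∑ i ∈ Finset.univ.filter (fun i => i ≠ (0 : Fin n)),
        x i * Function.update v 0 (√s) i =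
        ∑ i ∈ Finset.univ.filter (fun i => i ≠ (0 : Fin n)), x i * v i := fun x =>
      Finset.sum_congr rfl fun i hi => by
        rw [Function.update_of_ne (Finset.mem_filter.mp hi).2]
    have hu : FutureCausal (Function.update v 0 (√s)) := by
      refine ⟨?_, by simpa using hr⟩
      rw [eta, hsum, Finset.sum_congr rfl fun i _ => mul_comm _ _, hsum, ← hs]
      simp [hrr]
    have hpos := h _ hu
    rw [eta, hsum, ← hs, Function.update_self] at hpos
    have hle : √s ≤ v 0 := le_of_mul_le_mul_right (by linarith) hr
    refine .inr ⟨?_, hr.trans_le hle⟩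
    rw [hvv]
    nlinarith

theorem dual_of_causal_cone (n : ℕ) [NeZero n] (hn : 2 ≤ n)
    (w : (Fin n → ℝ) →ₗ[ℝ] ℝ) :
    (∀ u : Fin n → ℝ, FutureCausal u → 0 ≤ w u) ↔
      ∃ v : Fin n → ℝ, (∀ y : Fin n → ℝ, w y = eta v y) ∧ (v = 0 ∨ FutureCausal v) := by
  constructor
  · intro h
    obtain ⟨v, hv⟩ := exists_eq_eta w
    exact ⟨v, hv, eq_zero_or_futureCausal_of_eta_nonneg fun u hu => hv u ▸ h u hu⟩
  · rintro ⟨v, hv, rfl | hcausal⟩ u hu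
    · simp [hv, eta]
    · exact hv u ▸ hcausal.eta_nonneg hu

end PaperCausal
end

section
/- (Orthogonal future causal vectors are proportional null vectors; the key fact underlying Lemma 2 of the paper.) Let n ≥ 2 and let u, X ∈ Θ⁺ be future-directed causal vectors of n-dimensional Minkowski vector space with η u X = 0. Then η u u = 0, η X X = 0, and there exists λ > 0 with u = λ • X. -/
namespace PaperCausal

variable {n : ℕ}

/-- Expansion of the Lorentzian square of `a • x - b • y`. -/
theorem eta_smul_sub_smul_self [NeZero n] (a b : ℝ) (x y : Fin n → ℝ) :
    eta (a • x - b • y) (a • x - b • y) =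
      a ^ 2 * eta x x - 2 * a * b * eta x y + b ^ 2 * eta y y := by
  have hsum : ∑ i ∈ Finset.univ.filter (fun i => i ≠ (0 : Fin n)),
      (a • x - b • y) i * (a • x - b • y) i =
      a ^ 2 * ∑ i ∈ Finset.univ.filter (fun i => i ≠ (0 : Fin n)), x i * x i
      - 2 * a * b * ∑ i ∈ Finset.univ.filter (fun i => i ≠ (0 : Fin n)), x i * y i
      + b ^ 2 * ∑ i ∈ Finset.univ.filter (fun i => i ≠ (0 : Fin n)), y i * y i := by
    simp only [Finset.mul_sum, ← Finset.sum_sub_distrib, ← Finset.sum_add_distrib]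
    refine Finset.sum_congr rfl fun i _ => ?_
    simp only [Pi.sub_apply, Pi.smul_apply, smul_eq_mul]
    ring
  unfold eta
  rw [hsum]
  simp only [Pi.sub_apply, Pi.smul_apply, smul_eq_mul]
  ring

/-- The Lorentzian form is nonpositive on purely spatial vectors. -/
theorem eta_self_nonpos_of_apply_zero_eq_zero [NeZero n] {w : Fin n → ℝ} (h0 : w 0 = 0) :
    eta w w ≤ 0 := by
  unfold eta
  rw [h0, zero_mul, zero_sub, neg_nonpos]
  exact Finset.sum_nonneg fun i _ => mul_self_nonneg (w i)

/-- A purely spatial null vector vanishes. -/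
theorem eq_zero_of_apply_zero_eq_zero_of_eta_self_eq_zero [NeZero n] {w : Fin n → ℝ}
    (h0 : w 0 = 0) (h : eta w w = 0) : w = 0 := by
  unfold eta at h
  rw [h0, zero_mul, zero_sub, neg_eq_zero,
    Finset.sum_eq_zero_iff_of_nonneg fun i _ => mul_self_nonneg (w i)] at h
  funext i
  by_cases hi : i = 0
  · rw [hi, h0, Pi.zero_apply]
  · exact mul_self_eq_zero.mp (h i (by simp [hi]))

theorem orthogonal_causal_proportional_null (n : ℕ) [NeZero n] (hn : 2 ≤ n)
    (u X : Fin n → ℝ) (hu : FutureCausal u) (hX : FutureCausal X)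
    (horth : eta u X = 0) :
    eta u u = 0 ∧ eta X X = 0 ∧ ∃ l : ℝ, 0 < l ∧ u = l • X := by
  obtain ⟨huu, hu0⟩ := hu
  obtain ⟨hXX, hX0⟩ := hX
  have hw0 : (X 0 • u - u 0 • X) 0 = 0 := by
    simp only [Pi.sub_apply, Pi.smul_apply, smul_eq_mul]
    ring
  have hexp := eta_smul_sub_smul_self (X 0) (u 0) u X
  rw [horth, mul_zero, sub_zero] at hexp
  have hle := eta_self_nonpos_of_apply_zero_eq_zero hw0
  have hu_nonneg : 0 ≤ X 0 ^ 2 * eta u u := by positivity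
  have hX_nonneg : 0 ≤ u 0 ^ 2 * eta X X := by positivity
  have hu_zero : X 0 ^ 2 * eta u u = 0 := by linarith
  have hX_zero : u 0 ^ 2 * eta X X = 0 := by linarith
  have hw := eq_zero_of_apply_zero_eq_zero_of_eta_self_eq_zero hw0 (by linarith)
  refine ⟨(mul_eq_zero.mp hu_zero).resolve_left (by positivity),
    (mul_eq_zero.mp hX_zero).resolve_left (by positivity), u 0 / X 0, by positivity, ?_⟩
  rw [div_eq_inv_mul, mul_smul, ← sub_eq_zero.mp hw, inv_smul_smul₀ hX0.ne']

end PaperCausal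
end

section
/- (Theorem 1 of the paper, pointwise/linear form.) Let n ≥ 2 and let φ : V ≃ V be a linear equivalence of n-dimensional Minkowski vector space. Then the pullback bilinear form (x, y) ↦ η (φ x) (φ y) has the dominant property (lies in DP⁺_2) if and only if either φ x ∈ Θ⁺ for every x ∈ Θ⁺ (φ is a causal relation), or -φ x ∈ Θ⁺ for every x ∈ Θ⁺ (φ is an anticausal relation). -/
namespace PaperCausal

variable {n : ℕ}

theorem eta_neg_neg [NeZero n] (x y : Fin n → ℝ) : eta (-x) (-y) = eta x y := by
  simp [eta]

theorem eta_smul_add_smul [NeZero n] (a b : ℝ) (x y : Fin n → ℝ) :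
    eta (a • x + b • y) (a • x + b • y) =
      a ^ 2 * eta x x + 2 * (a * b) * eta x y + b ^ 2 * eta y y := by
  simp only [eta, Pi.add_apply, Pi.smul_apply, smul_eq_mul, mul_sub, Finset.mul_sum]
  have h : ∀ i : Fin n, (a * x i + b * y i) * (a * x i + b * y i) =
      a ^ 2 * (x i * x i) + 2 * (a * b) * (x i * y i) + b ^ 2 * (y i * y i) := fun i => by ring
  simp only [h, Finset.sum_add_distrib]
  ring

/-- The causal cone is closed under positive linear combinations. -/
theorem FutureCausal.smul_add_smul [NeZero n] {x y : Fin n → ℝ} (hx : FutureCausal x)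
    (hy : FutureCausal y) {a b : ℝ} (ha : 0 < a) (hb : 0 < b) :
    FutureCausal (a • x + b • y) := by
  refine ⟨?_, add_pos (mul_pos ha hx.2) (mul_pos hb hy.2)⟩
  rw [eta_smul_add_smul]
  have hxx := hx.1
  have hyy := hy.1
  have hxy := hx.eta_nonneg hy
  positivity

theorem eq_zero_of_eta_self_nonneg [NeZero n] {x : Fin n → ℝ} (hx : 0 ≤ eta x x)
    (h0 : x 0 = 0) : x = 0 := by
  have hsum : ∑ i ∈ Finset.univ.filter (fun i => i ≠ (0 : Fin n)), x i * x i = 0 := by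
    refine le_antisymm ?_ (Finset.sum_nonneg fun i _ => mul_self_nonneg (x i))
    simpa [eta, h0] using hx
  rw [Finset.sum_eq_zero_iff_of_nonneg fun i _ => mul_self_nonneg (x i)] at hsum
  funext i
  by_cases hi : i = 0
  · rw [hi, h0, Pi.zero_apply]
  · exact mul_self_eq_zero.mp (hsum i (by simp [hi]))

theorem theorem1_causal_char (n : ℕ) [NeZero n] (hn : 2 ≤ n)
    (φ : (Fin n → ℝ) ≃ₗ[ℝ] (Fin n → ℝ)) :
    (∀ x y : Fin n → ℝ, FutureCausal x → FutureCausal y → 0 ≤ eta (φ x) (φ y)) ↔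
      ((∀ x : Fin n → ℝ, FutureCausal x → FutureCausal (φ x)) ∨
       (∀ x : Fin n → ℝ, FutureCausal x → FutureCausal (-(φ x)))) := by
  constructor
  · intro h
    have hne : ∀ x : Fin n → ℝ, FutureCausal x → φ x 0 ≠ 0 := by
      intro x hx h0
      have hx_zero : x = 0 :=
        φ.map_eq_zero_iff.mp (eq_zero_of_eta_self_nonneg (h x x hx hx) h0)
      exact hx.2.ne' (congrFun hx_zero 0)
    by_cases hpos : ∀ x : Fin n → ℝ, FutureCausal x → 0 < φ x 0
    · exact Or.inl fun x hx => ⟨h x x hx hx, hpos x hx⟩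
    · push Not at hpos
      obtain ⟨y, hy, hy0⟩ := hpos
      refine Or.inr fun x hx => ⟨by rw [eta_neg_neg]; exact h x x hx hx, neg_pos.mpr ?_⟩
      by_contra! hx0
      have ha : 0 < -(φ y 0) := neg_pos.mpr (lt_of_le_of_ne hy0 (hne y hy))
      have hb : 0 < φ x 0 := lt_of_le_of_ne hx0 (hne x hx).symm
      refine hne _ (hx.smul_add_smul hy ha hb) ?_
      simp only [map_add, map_smul, Pi.add_apply, Pi.smul_apply, smul_eq_mul]
      ring
  · rintro (h | h) x y hx hy
    · exact (h x hx).eta_nonneg (h y hy)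
    · rw [← eta_neg_neg]
      exact (h x hx).eta_nonneg (h y hy)

end PaperCausal
end

section
/- (Proposition 3 of the paper, parts (i)–(ii), pointwise/linear form.) Let n ≥ 2 and let φ : V ≃ V be a linear equivalence of n-dimensional Minkowski vector space which is a causal relation. Then: (i) if X is future-directed timelike then φ X is future-directed timelike; (ii) if X ∈ Θ⁺ and η (φ X) (φ X) = 0 then η X X = 0. -/
namespace PaperCausal

variable {n : ℕ}

/-- Subtracting a sufficiently small multiple of any vector from a future timelike vector
leaves it future causal. -/
theorem FutureTimelike.eventually_futureCausal_sub_smul [NeZero n] {x : Fin n → ℝ}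
    (hx : FutureTimelike x) (y : Fin n → ℝ) :
    ∀ᶠ ε : ℝ in nhds 0, FutureCausal (x - ε • y) := by
  have hη : Continuous fun ε : ℝ => eta (x - ε • y) (x - ε • y) := by
    unfold eta
    simp only [Pi.sub_apply, Pi.smul_apply]
    fun_prop
  have hzero : Continuous fun ε : ℝ => (x - ε • y) 0 := by
    simp only [Pi.sub_apply, Pi.smul_apply]
    fun_prop
  filter_upwards [hη.continuousAt.eventually_const_lt (u := 0) (by simpa using hx.1),
    hzero.continuousAt.eventually_const_lt (u := 0) (by simpa using hx.2)] with ε h₁ h₂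
  exact ⟨h₁.le, h₂⟩

theorem eta_sub_smul_single [NeZero n] (x : Fin n → ℝ) (ε : ℝ) :
    eta (x - ε • Pi.single 0 1) (x - ε • Pi.single 0 1) = eta x x - ε * (2 * x 0 - ε) := by
  have h : ∑ i ∈ Finset.univ.filter (fun i => i ≠ (0 : Fin n)),
      (x - ε • Pi.single 0 1 : Fin n → ℝ) i * (x - ε • Pi.single 0 1 : Fin n → ℝ) i =
      ∑ i ∈ Finset.univ.filter (fun i => i ≠ (0 : Fin n)), x i * x i := by
    refine Finset.sum_congr rfl fun i hi => ?_
    simp [Pi.single_eq_of_ne (Finset.mem_filter.1 hi).2]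
  rw [eta, h, eta]
  simp only [Pi.sub_apply, Pi.smul_apply, Pi.single_eq_same, smul_eq_mul]
  ring

/-- An invertible causal relation preserves future timelike vectors. -/
theorem FutureTimelike.map_of_causal [NeZero n] {φ : (Fin n → ℝ) ≃ₗ[ℝ] (Fin n → ℝ)}
    (hφ : ∀ x : Fin n → ℝ, FutureCausal x → FutureCausal (φ x)) {x : Fin n → ℝ}
    (hx : FutureTimelike x) : FutureTimelike (φ x) := by
  have hφx : 0 < (φ x) 0 := (hφ x ⟨hx.1.le, hx.2⟩).2
  have hev := hx.eventually_futureCausal_sub_smul (φ.symm (Pi.single 0 1))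
  obtain ⟨ε, ⟨hε, hlt⟩, hpos : 0 < ε⟩ := (((hev.and (eventually_lt_nhds hφx)).filter_mono
    nhdsWithin_le_nhds).and (eventually_mem_nhdsWithin (s := Set.Ioi (0 : ℝ)))).exists
  have h := (hφ _ hε).1
  rw [map_sub, map_smul, LinearEquiv.apply_symm_apply, eta_sub_smul_single] at h
  have hmul : 0 < ε * (2 * (φ x) 0 - ε) := mul_pos hpos (by linarith)
  exact ⟨by linarith, hφx⟩

theorem proposition3_i_ii (n : ℕ) [NeZero n] (hn : 2 ≤ n)
    (φ : (Fin n → ℝ) ≃ₗ[ℝ] (Fin n → ℝ))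
    (hφ : ∀ x : Fin n → ℝ, FutureCausal x → FutureCausal (φ x)) :
    (∀ X : Fin n → ℝ, FutureTimelike X → FutureTimelike (φ X)) ∧
    (∀ X : Fin n → ℝ, FutureCausal X → eta (φ X) (φ X) = 0 → eta X X = 0) := by
  refine ⟨fun X hX => hX.map_of_causal hφ, fun X hX h => ?_⟩
  by_contra hne
  exact (FutureTimelike.map_of_causal hφ ⟨lt_of_le_of_ne hX.1 (Ne.symm hne), hX.2⟩).1.ne' h

end PaperCausal
end

section
/- (Proposition 3 of the paper, parts (iii)–(iv), pointwise/linear form for one-forms.) Let n ≥ 2, let φ : V ≃ V be a linear equivalence of n-dimensional Minkowski vector space which is a causal relation, let v ∈ V, and let u ∈ V be the vector satisfying η u y = η v (φ y) for all y ∈ V (the metric dual of the pullback under φ of the one-form η v ·). Then: (iii) if v is future-directed timelike then u is future-directed timelike; (iv) if v ∈ Θ⁺ and η u u = 0 then η v v = 0. -/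
namespace PaperCausal

variable {n : ℕ}

theorem FutureTimelike.eta_pos {n : ℕ} [NeZero n] {v w : Fin n → ℝ}
    (hv : FutureTimelike v) (hw : FutureCausal w) : 0 < eta v w := by
  obtain ⟨hvv, hv0⟩ := hv
  obtain ⟨hww, hw0⟩ := hw
  unfold eta at *
  have cauchy_schwarz := Finset.sum_mul_sq_le_sq_mul_sq
    (Finset.univ.filter (fun i => i ≠ (0 : Fin n))) v w
  simp only [← sq] at hvv hww
  set s := Finset.univ.filter (fun i => i ≠ (0 : Fin n))
  have hv_nonneg : 0 ≤ ∑ i ∈ s, v i ^ 2 := Finset.sum_nonneg fun i _ => sq_nonneg _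
  have hsq : (∑ i ∈ s, v i * w i) ^ 2 < (v 0 * w 0) ^ 2 :=
    calc (∑ i ∈ s, v i * w i) ^ 2
        ≤ (∑ i ∈ s, v i ^ 2) * ∑ i ∈ s, w i ^ 2 := cauchy_schwarz
      _ ≤ (∑ i ∈ s, v i ^ 2) * w 0 ^ 2 := by gcongr; linarith
      _ < v 0 ^ 2 * w 0 ^ 2 := by gcongr; linarith
      _ = (v 0 * w 0) ^ 2 := by ring
  linarith [lt_of_pow_lt_pow_left₀ 2 (by positivity) hsq]

theorem FutureTimelike.of_forall_eta_pos {n : ℕ} [NeZero n] {u : Fin n → ℝ}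
    (hu : ∀ y, FutureCausal y → 0 < eta u y) : FutureTimelike u := by
  let s := Finset.univ.filter (fun i => i ≠ (0 : Fin n))
  have sum_update (x : Fin n → ℝ) (a b : Fin n → ℝ) (ha : ∀ i ≠ 0, a i = b i) :
      ∑ i ∈ s, x i * a i = ∑ i ∈ s, x i * b i :=
    Finset.sum_congr rfl fun i hi => by rw [ha i (Finset.mem_filter.mp hi).2]
  have hu0 : 0 < u 0 := by
    have hsum (x : Fin n → ℝ) : eta x (Pi.single 0 1) = x 0 := by
      have := sum_update x (Pi.single 0 1) 0 fun i hi => by simp [hi]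
      simp only [Pi.zero_apply, mul_zero, Finset.sum_const_zero] at this
      simp [eta, s, this]
    simpa [hsum] using hu (Pi.single 0 1) (by simp [FutureCausal, hsum])
  have hS : 0 ≤ ∑ i ∈ s, u i * u i := Finset.sum_nonneg fun i _ => mul_self_nonneg _
  have huu : eta u u = u 0 * u 0 - ∑ i ∈ s, u i * u i := rfl
  refine ⟨?_, hu0⟩
  obtain hzero | hpos := hS.eq_or_lt
  · rw [huu, ← hzero, sub_zero]
    positivity
  · set r := √(∑ i ∈ s, u i * u i) with hr
    have hr_pos : 0 < r := Real.sqrt_pos.mpr hpos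
    have hr_sq : r * r = ∑ i ∈ s, u i * u i := Real.mul_self_sqrt hS
    let y := Function.update u 0 r
    have hy : ∀ i ≠ 0, y i = u i := fun i hi => Function.update_of_ne hi _ _
    have hy0 : y 0 = r := Function.update_self _ _ _
    have huy : eta u y = u 0 * r - r * r := by
      rw [hr_sq, ← sum_update u y u hy, ← hy0]; rfl
    have hyy : eta y y = 0 := by
      have : ∑ i ∈ s, y i * y i = r * r := by
        rw [sum_update y y u hy, hr_sq, ← sum_update u y u hy]
        simp only [mul_comm]
      change y 0 * y 0 - ∑ i ∈ s, y i * y i = 0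
      rw [this, hy0, sub_self]
    have hlt := hu y ⟨hyy.ge, hy0 ▸ hr_pos⟩
    rw [huy] at hlt
    rw [huu, ← hr_sq]
    nlinarith

theorem proposition3_iii_iv (n : ℕ) [NeZero n] (hn : 2 ≤ n)
    (φ : (Fin n → ℝ) ≃ₗ[ℝ] (Fin n → ℝ))
    (hφ : ∀ x : Fin n → ℝ, FutureCausal x → FutureCausal (φ x))
    (v u : Fin n → ℝ) (hu : ∀ y : Fin n → ℝ, eta u y = eta v (φ y)) :
    (FutureTimelike v → FutureTimelike u) ∧
    (FutureCausal v → eta u u = 0 → eta v v = 0) := by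
  have timelike (hv : FutureTimelike v) : FutureTimelike u :=
    .of_forall_eta_pos fun y hy => hu y ▸ hv.eta_pos (hφ y hy)
  refine ⟨timelike, fun hv huu => ?_⟩
  by_contra hvv
  exact (timelike ⟨hv.1.lt_of_ne' hvv, hv.2⟩).1.ne' huu

end PaperCausal
end

section
/- (Proposition 4 of the paper, pointwise/linear form: which null directions are preserved.) Let n ≥ 2, let φ : V ≃ V be a linear equivalence of n-dimensional Minkowski vector space which is a causal relation, and let X ∈ Θ⁺. Then η (φ X) (φ X) = 0 if and only if X is a null eigenvector of the pullback form T(x, y) = η (φ x) (φ y), i.e. η X X = 0 and there exists λ ∈ ℝ with η (φ y) (φ X) = λ * η y X for all y ∈ V. -/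
namespace PaperCausal

variable {n : ℕ}

lemma eta_comm [NeZero n] (x y : Fin n → ℝ) : eta x y = eta y x := by
  simp only [eta, mul_comm]

lemma eta_add_left [NeZero n] (x y z : Fin n → ℝ) : eta (x + y) z = eta x z + eta y z := by
  simp only [eta, Pi.add_apply, add_mul, Finset.sum_add_distrib]
  ring

lemma eta_smul_left [NeZero n] (t : ℝ) (x z : Fin n → ℝ) : eta (t • x) z = t * eta x z := by
  simp only [eta, Pi.smul_apply, smul_eq_mul, mul_assoc, ← Finset.mul_sum]
  ring

lemma eta_add_smul_self [NeZero n] (x y : Fin n → ℝ) (t : ℝ) :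
    eta (x + t • y) (x + t • y) = eta x x + t * (2 * eta y x + t * eta y y) := by
  rw [eta_add_left, eta_smul_left, eta_comm x, eta_comm y, eta_add_left, eta_add_left,
    eta_smul_left, eta_smul_left, eta_comm x y]
  ring

lemma eta_single_zero [NeZero n] (x : Fin n → ℝ) : eta (Pi.single 0 1) x = x 0 := by
  rw [eta, Finset.sum_eq_zero, Pi.single_eq_same, one_mul, sub_zero]
  intro i hi
  rw [Pi.single_eq_of_ne (Finset.mem_filter.1 hi).2, zero_mul]

lemma eventually_pos_add_mul {a : ℝ} (ha : 0 < a) (b : ℝ) :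
    ∀ᶠ t in nhdsWithin (0 : ℝ) (Set.Ioi 0), 0 < a + t * b := by
  have h : ContinuousAt (fun t : ℝ => a + t * b) 0 := by fun_prop
  exact (h.eventually_mem (Ioi_mem_nhds (by simpa using ha))).filter_mono nhdsWithin_le_nhds

lemma nonneg_of_eventually_add_mul {a b : ℝ}
    (h : ∀ᶠ t in nhdsWithin (0 : ℝ) (Set.Ioi 0), 0 ≤ a + t * b) : 0 ≤ a := by
  by_contra! ha
  obtain ⟨t, ht, ht'⟩ := (h.and (eventually_pos_add_mul (neg_pos.2 ha) (-b))).exists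
  linarith

/-- If a future causal vector `x` has null image under a causal relation, then the covector
`eta (φ ·) (φ x)` is nonnegative on the open half-space where `eta · x` is positive. -/
lemma eta_map_nonneg_of_eta_pos [NeZero n] (φ : (Fin n → ℝ) →ₗ[ℝ] (Fin n → ℝ))
    (hφ : ∀ x : Fin n → ℝ, FutureCausal x → FutureCausal (φ x))
    {x y : Fin n → ℝ} (hx : FutureCausal x) (h0 : eta (φ x) (φ x) = 0) (hy : 0 < eta y x) :
    0 ≤ eta (φ y) (φ x) := by
  suffices h : 0 ≤ 2 * eta (φ y) (φ x) by linarith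
  apply nonneg_of_eventually_add_mul (b := eta (φ y) (φ y))
  filter_upwards [self_mem_nhdsWithin, eventually_pos_add_mul hx.2 (y 0),
    eventually_pos_add_mul (mul_pos two_pos hy) (eta y y)] with t ht h1 h2
  have hc : FutureCausal (x + t • y) := by
    refine ⟨?_, by simpa using h1⟩
    rw [eta_add_smul_self]
    exact add_nonneg hx.1 (mul_pos ht h2).le
  have h3 := (hφ _ hc).1
  rw [map_add, map_smul, eta_add_smul_self, h0, zero_add] at h3
  exact nonneg_of_mul_nonneg_right h3 ht

/-- If a future causal vector `x` has null image under a causal relation, then the covector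
`eta (φ ·) (φ x)` vanishes on the hyperplane where `eta · x` does. -/
lemma eta_map_eq_zero_of_eta_eq_zero [NeZero n] (φ : (Fin n → ℝ) →ₗ[ℝ] (Fin n → ℝ))
    (hφ : ∀ x : Fin n → ℝ, FutureCausal x → FutureCausal (φ x))
    {x y : Fin n → ℝ} (hx : FutureCausal x) (h0 : eta (φ x) (φ x) = 0) (hy : eta y x = 0) :
    eta (φ y) (φ x) = 0 := by
  have key : ∀ z, eta z x = 0 → 0 ≤ eta (φ z) (φ x) := by
    intro z hz
    apply nonneg_of_eventually_add_mul (b := eta (φ (Pi.single 0 1)) (φ x))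
    filter_upwards [self_mem_nhdsWithin] with t ht
    rw [← eta_smul_left, ← eta_add_left, ← map_smul, ← map_add]
    apply eta_map_nonneg_of_eta_pos φ hφ hx h0
    rw [eta_add_left, eta_smul_left, hz, eta_single_zero, zero_add]
    exact mul_pos ht hx.2
  have h := key ((-1 : ℝ) • y) (by rw [eta_smul_left, hy, mul_zero])
  rw [map_smul, eta_smul_left] at h
  linarith [key y hy]

theorem proposition4_canonical_null (n : ℕ) [NeZero n] (hn : 2 ≤ n)
    (φ : (Fin n → ℝ) ≃ₗ[ℝ] (Fin n → ℝ))
    (hφ : ∀ x : Fin n → ℝ, FutureCausal x → FutureCausal (φ x))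
    (X : Fin n → ℝ) (hX : FutureCausal X) :
    eta (φ X) (φ X) = 0 ↔
      (eta X X = 0 ∧ ∃ l : ℝ, ∀ y : Fin n → ℝ, eta (φ y) (φ X) = l * eta y X) := by
  constructor
  · intro h0
    set e : Fin n → ℝ := Pi.single 0 1
    have hl : ∀ y, eta (φ y) (φ X) = eta (φ e) (φ X) / X 0 * eta y X := by
      intro y
      have h := eta_map_eq_zero_of_eta_eq_zero (φ : (Fin n → ℝ) →ₗ[ℝ] (Fin n → ℝ)) hφ hX h0
        (y := y + (-(eta y X / X 0)) • e) (by
          rw [eta_add_left, eta_smul_left, eta_single_zero]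
          field_simp [hX.2.ne']
          ring)
      rw [map_add, map_smul, eta_add_left, eta_smul_left] at h
      simp only [LinearEquiv.coe_coe] at h
      linear_combination h
    refine ⟨?_, _, hl⟩
    have hne : eta (φ e) (φ X) / X 0 ≠ 0 := by
      intro h
      have h1 := hl (φ.symm e)
      rw [h, zero_mul, φ.apply_symm_apply, eta_single_zero] at h1
      exact (hφ X hX).2.ne' h1
    exact (mul_eq_zero.1 ((hl X).symm.trans h0)).resolve_left hne
  · rintro ⟨h0, l, hl⟩
    rw [hl, h0, mul_zero]

end PaperCausal
end

section
/- (Example 1 of the paper, pointwise/linear form: time dilations of Minkowski space.) Let n ≥ 2, let b ∈ ℝ, and let φ_b : V → V be the linear map on n-dimensional Minkowski vector space defined by (φ_b x) 0 = b * x 0 and (φ_b x) i = x i for i ≠ 0. Then φ_b is a causal relation (φ_b x ∈ Θ⁺ for every x ∈ Θ⁺) if and only if b ≥ 1. -/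
namespace PaperCausal

variable {n : ℕ}

/-- The dilation by `b` rescales only the temporal part of the Minkowski form. -/
theorem eta_time_dilation [NeZero n] {b : ℝ} {x y : Fin n → ℝ} (h0 : y 0 = b * x 0)
    (hi : ∀ i : Fin n, i ≠ 0 → y i = x i) :
    eta y y = eta x x + (b ^ 2 - 1) * x 0 ^ 2 := by
  have hs : ∑ i ∈ Finset.univ.filter (fun i => i ≠ (0 : Fin n)), y i * y i =
      ∑ i ∈ Finset.univ.filter (fun i => i ≠ (0 : Fin n)), x i * x i :=
    Finset.sum_congr rfl fun i h => by rw [hi i (Finset.mem_filter.mp h).2]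
  rw [eta, eta, hs, h0]
  ring

/-- The sum of the time axis and a spatial axis is a null vector. -/
theorem futureNull_single_add_single [NeZero n] {k : Fin n} (hk : k ≠ 0) :
    FutureNull (Pi.single 0 1 + Pi.single k 1 : Fin n → ℝ) := by
  have h0 : (Pi.single 0 1 + Pi.single k 1 : Fin n → ℝ) 0 = 1 := by
    simp [hk.symm]
  refine ⟨?_, one_pos.trans_eq h0.symm⟩
  rw [eta, h0, Finset.sum_eq_single_of_mem k (by simp [hk])]
  · simp [hk]
  · intro i hi hik
    simp [hik, (Finset.mem_filter.mp hi).2]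

theorem example1_time_dilation (n : ℕ) [NeZero n] (hn : 2 ≤ n) (b : ℝ)
    (φb : (Fin n → ℝ) → (Fin n → ℝ))
    (hφ0 : ∀ x : Fin n → ℝ, φb x 0 = b * x 0)
    (hφi : ∀ (x : Fin n → ℝ) (i : Fin n), i ≠ 0 → φb x i = x i) :
    (∀ x : Fin n → ℝ, FutureCausal x → FutureCausal (φb x)) ↔ 1 ≤ b := by
  constructor
  · intro h
    have hk : (⟨1, hn⟩ : Fin n) ≠ 0 := by
      simp [Fin.ext_iff]
    obtain ⟨hx, hx0⟩ := futureNull_single_add_single hk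
    set x : Fin n → ℝ := Pi.single 0 1 + Pi.single ⟨1, hn⟩ 1
    obtain ⟨hc, hpos⟩ := h x ⟨hx.ge, hx0⟩
    rw [eta_time_dilation (hφ0 x) (hφi x), hx, zero_add] at hc
    rw [hφ0] at hpos
    have hb : 0 < b := pos_of_mul_pos_left hpos hx0.le
    have hb2 : 0 ≤ b ^ 2 - 1 := nonneg_of_mul_nonneg_left hc (by positivity)
    nlinarith
  · rintro hb x ⟨hx, hx0⟩
    refine ⟨?_, ?_⟩
    · rw [eta_time_dilation (hφ0 x) (hφi x)]
      have hb2 : 0 ≤ b ^ 2 - 1 := by nlinarith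
      positivity
    · rw [hφ0]
      positivity

end PaperCausal
end
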